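/- arXiv:2007.10772 — 2 statements merged into one kernel-verified Lean document; each statement's English description precedes it below -/
import Mathlib

section
/- For every integer n ≥ 1 and all indices 1 ≤ i < j ≤ n, the equality (ρ_1 ρ_n)^{n−j+1} ρ_i = ρ_{n−j+i+1} (ρ_1 ρ_n)^{n−j} ρ_j holds in the monoid M_n. -/
/-- The defining relations of the monoid `M_n`: the generator `k : Fin n` represents `ρ_{k+1}`
(so that `ρ_i` corresponds to the index `i - 1`), and the relations are
`ρ_1 ρ_n ρ_i = ρ_{i+1} ρ_n` for `1 ≤ i ≤ n - 1`. -/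
inductive MnRel (n : ℕ) : FreeMonoid (Fin n) → FreeMonoid (Fin n) → Prop
  | rel (i : ℕ) (h1 : 1 ≤ i) (h2 : i ≤ n - 1) :
      MnRel n
        (FreeMonoid.of ⟨1 - 1, by omega⟩ * FreeMonoid.of ⟨n - 1, by omega⟩ *
          FreeMonoid.of ⟨i - 1, by omega⟩)
        (FreeMonoid.of ⟨i + 1 - 1, by omega⟩ * FreeMonoid.of ⟨n - 1, by omega⟩)

/-- The presented monoid `M_n`. -/
abbrev Mn (n : ℕ) := PresentedMonoid (MnRel n)

/-- The generator `ρ_i` of `M_n`, for `1 ≤ i ≤ n` (junk value `1` out of range). -/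
def rho (n : ℕ) (i : ℕ) : Mn n :=
  if h : 1 ≤ i ∧ i ≤ n then PresentedMonoid.of (MnRel n) ⟨i - 1, by omega⟩ else 1

/-- `a` left-divides `c`: `c = a * b` for some `b`. -/
def LDvd {M : Type*} [Monoid M] (a c : M) : Prop := ∃ b, a * b = c

/-- `a` right-divides `c`: `c = b * a` for some `b`. -/
def RDvd {M : Type*} [Monoid M] (a c : M) : Prop := ∃ b, b * a = c

theorem rho_rel (n i : ℕ) (h1 : 1 ≤ i) (h2 : i < n) :
    rho n 1 * rho n n * rho n i = rho n (i + 1) * rho n n := by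
  have h := Quotient.sound (s := (conGen (MnRel n)).toSetoid) (ConGen.Rel.of _ _ (MnRel.rel (n := n) i h1 (by omega)))
  have e1 : (1 ≤ 1 ∧ 1 ≤ n) := by omega
  have e2 : (1 ≤ n ∧ n ≤ n) := by omega
  have e3 : (1 ≤ i ∧ i ≤ n) := by omega
  have e4 : (1 ≤ i + 1 ∧ i + 1 ≤ n) := by omega
  unfold rho
  rw [dif_pos e1, dif_pos e2, dif_pos e3, dif_pos e4]
  exact h

theorem rho_aux (n k : ℕ) : ∀ i, 1 ≤ i → i + k < n →
    (rho n 1 * rho n n) ^ (k + 1) * rho n i =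
      rho n (k + i + 1) * (rho n 1 * rho n n) ^ k * rho n (n - k) := by
  induction k with
  | zero =>
    intro i h1 h2
    simpa using rho_rel n i h1 (by omega)
  | succ k ih =>
    intro i h1 h2
    have a := ih i h1 (by omega)
    have b := ih (n - (k + 1)) (by omega) (by omega)
    have c := rho_rel n (k + i + 1) (by omega) (by omega)
    rw [show k + (n - (k + 1)) + 1 = n by omega] at b
    rw [show k + 1 + i + 1 = k + i + 1 + 1 by omega, pow_succ' _ (k + 1), mul_assoc, a,
      mul_assoc (rho n (k + i + 1 + 1)), b]
    simp only [← mul_assoc]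
    rw [c]

/-- For `1 ≤ i < j ≤ n`, the equality
`(ρ_1 ρ_n)^{n-j+1} ρ_i = ρ_{n-j+i+1} (ρ_1 ρ_n)^{n-j} ρ_j` holds in `M_n`. -/
theorem stmt2 (n i j : ℕ) (hn : 1 ≤ n) (hi : 1 ≤ i) (hij : i < j) (hj : j ≤ n) :
    (rho n 1 * rho n n) ^ (n - j + 1) * rho n i =
      rho n (n - j + i + 1) * (rho n 1 * rho n n) ^ (n - j) * rho n j := by
  have h := rho_aux n (n - j) i hi (by omega)
  rwa [show n - (n - j) = j by omega] at h
end

section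
/- For every integer n ≥ 1, the following hold in M_n, where Δ = ρ_n^{n+1}: (1) ρ_1 (ρ_n ρ_1)^{n−1} = ρ_n^n, and hence Δ = (ρ_1 ρ_n)^n = (ρ_n ρ_1)^n; (2) for every 1 ≤ i ≤ n, setting a_i = ρ_n^i (ρ_1 ρ_n)^{n−i}, one has ρ_i a_i = a_i ρ_i = Δ; in particular every generator ρ_i both left-divides and right-divides Δ, and Δ commutes with every element of M_n; (3) for all a, b ∈ M_n, if a·b = Δ then b·a = Δ. -/
namespace MnAux

open Relation

variable {n : ℕ}

/-- Zero-based generators. -/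
def g (n : ℕ) (i : ℕ) : Mn n := if h : i < n then PresentedMonoid.of (MnRel n) ⟨i, h⟩ else 1

/-- The value of a word. -/
def q (n : ℕ) (l : List (Fin n)) : Mn n := PresentedMonoid.mk (MnRel n) (FreeMonoid.ofList l)

theorem q_cons (a : Fin n) (l : List (Fin n)) : q n (a :: l) = g n a * q n l := by
  unfold q g
  rw [dif_pos a.2, FreeMonoid.ofList_cons, map_mul]
  rfl

theorem q_surj (m : Mn n) : ∃ l, q n l = m := by
  induction m using PresentedMonoid.inductionOn with
  | _ z => exact ⟨FreeMonoid.toList z, rfl⟩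

theorem rho_eq (i : ℕ) (h1 : 1 ≤ i) (h2 : i ≤ n) : rho n i = g n (i - 1) := by
  unfold rho g
  rw [dif_pos ⟨h1, h2⟩, dif_pos (by omega)]

theorem g_rel (i : ℕ) (h : i + 1 < n) :
    g n 0 * (g n (n - 1) * g n i) = g n (i + 1) * g n (n - 1) := by
  have := (Con.eq (conGen (MnRel n))).2
    (ConGen.Rel.of _ _ (MnRel.rel (n := n) (i + 1) (by omega) (by omega)))
  unfold g
  rw [dif_pos (by omega), dif_pos (by omega), dif_pos (by omega), dif_pos (by omega), ← mul_assoc]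
  exact this

/-- One elementary rewriting step. -/
def Step (n : ℕ) (w w' : List (Fin n)) : Prop :=
  ∃ (p r : List (Fin n)) (i : ℕ) (h : i + 1 < n),
    w = p ++ ⟨0, by omega⟩ :: ⟨n - 1, by omega⟩ :: ⟨i, by omega⟩ :: r ∧
    w' = p ++ ⟨i + 1, h⟩ :: ⟨n - 1, by omega⟩ :: r

theorem Step.q_eq {w w' : List (Fin n)} (h : Step n w w') : q n w = q n w' := by
  obtain ⟨p, r, i, h, rfl, rfl⟩ := h
  induction p with
  | nil =>
    simp only [List.nil_append, q_cons]
    rw [← mul_assoc (g n (n - 1)), ← mul_assoc, g_rel i h, mul_assoc]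
  | cons a p ih => simp only [List.cons_append, q_cons, ih]

theorem eqv_left (p : List (Fin n)) {w w' : List (Fin n)} (h : EqvGen (Step n) w w') :
    EqvGen (Step n) (p ++ w) (p ++ w') := by
  induction h with
  | rel x y h =>
    obtain ⟨a, r, i, h, rfl, rfl⟩ := h
    exact .rel _ _ ⟨p ++ a, r, i, h, by simp, by simp⟩
  | refl x => exact .refl _
  | symm x y _ ih => exact .symm _ _ ih
  | trans x y z _ _ ih1 ih2 => exact .trans _ _ _ ih1 ih2

theorem eqv_right (p : List (Fin n)) {w w' : List (Fin n)} (h : EqvGen (Step n) w w') :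
    EqvGen (Step n) (w ++ p) (w' ++ p) := by
  induction h with
  | rel x y h =>
    obtain ⟨a, r, i, h, rfl, rfl⟩ := h
    exact .rel _ _ ⟨a, r ++ p, i, h, by simp, by simp⟩
  | refl x => exact .refl _
  | symm x y _ ih => exact .symm _ _ ih
  | trans x y z _ _ ih1 ih2 => exact .trans _ _ _ ih1 ih2

theorem eqv_of_rel {w w' : FreeMonoid (Fin n)} (h : ConGen.Rel (MnRel n) w w') :
    EqvGen (Step n) w.toList w'.toList := by
  induction h with
  | of x y h =>
    obtain ⟨i, h1, h2⟩ := h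
    obtain ⟨j, rfl⟩ : ∃ j, i = j + 1 := ⟨i - 1, by omega⟩
    exact .rel _ _ ⟨[], [], j, by omega, rfl, rfl⟩
  | refl x => exact .refl _
  | symm _ ih => exact .symm _ _ ih
  | trans _ _ ih1 ih2 => exact .trans _ _ _ ih1 ih2
  | mul _ _ ih1 ih2 =>
    rw [FreeMonoid.toList_mul, FreeMonoid.toList_mul]
    exact .trans _ _ _ (eqv_right _ ih1) (eqv_left _ ih2)

theorem eqv_of_q {w w' : List (Fin n)} (h : q n w = q n w') : EqvGen (Step n) w w' := by
  have h2 : conGen (MnRel n) (FreeMonoid.ofList w) (FreeMonoid.ofList w') := (Con.eq _).1 h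
  exact eqv_of_rel h2

/-- A predicate invariant under steps is invariant under equality in the monoid. -/
theorem inv_of_q (I : List (Fin n) → Prop) (hI : ∀ w w', Step n w w' → (I w ↔ I w'))
    {w w' : List (Fin n)} (h : q n w = q n w') : I w ↔ I w' := by
  have := eqv_of_q h
  induction this with
  | rel x y hs => exact hI _ _ hs
  | refl x => exact Iff.rfl
  | symm x y _ ih => exact (ih h.symm).symm
  | trans x y z h1 h2 ih1 ih2 =>
    have hq : ∀ {x y}, EqvGen (Step n) x y → q n x = q n y := by
      intro x y h
      induction h with
      | rel x y h => exact h.q_eq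
      | refl x => rfl
      | symm x y _ ih => exact ih.symm
      | trans x y z _ _ ih1 ih2 => exact ih1.trans ih2
    exact (ih1 (hq h1)).trans (ih2 (hq h2))

/-- The weight homomorphism. -/
def wtHom (n : ℕ) : Mn n →* Multiplicative ℕ :=
  PresentedMonoid.lift (fun i : Fin n => Multiplicative.ofAdd ((i : ℕ) + 1)) (by
    intro a b h
    obtain ⟨i, h1, h2⟩ := h
    simp only [map_mul, FreeMonoid.lift_eval_of, ← ofAdd_add]
    congr 1
    omega)

def wt (m : Mn n) : ℕ := Multiplicative.toAdd (wtHom n m)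

theorem wt_mul (a b : Mn n) : wt (a * b) = wt a + wt b := by
  simp [wt]

theorem wt_g (i : ℕ) (h : i < n) : wt (g n i) = i + 1 := by
  unfold wt g wtHom
  rw [dif_pos h, PresentedMonoid.lift_of]
  rfl

/-- Cancellation of generators below weight `D`. -/
def Canc (n D : ℕ) : Prop := ∀ i < n, ∀ u u' : Mn n, i + 1 + wt u < D →
  g n i * u = g n i * u' → u = u'

def I0 (u : Mn n) : List (Fin n) → Prop
  | [] => False
  | b :: v => ((b : ℕ) = 0 ∧ q n v = u) ∨
      ∃ i y, (b : ℕ) = i + 1 ∧ u = g n (n - 1) * (g n i * y) ∧ q n v = g n (n - 1) * y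

def I1 (k : ℕ) (u : Mn n) : List (Fin n) → Prop
  | [] => False
  | b :: v => ((b : ℕ) = k + 1 ∧ q n v = u) ∨
      (∃ y, (b : ℕ) = 0 ∧ u = g n (n - 1) * y ∧ q n v = g n (n - 1) * (g n k * y)) ∨
      ∃ j y y', j ≠ k ∧ (b : ℕ) = j + 1 ∧ u = g n (n - 1) * y ∧ q n v = g n (n - 1) * y' ∧
        g n (n - 1) * (g n k * y) = g n (n - 1) * (g n j * y')

theorem I0_step {D : ℕ} (hD : Canc n D) (u : Mn n) (hu : 1 + wt u = D) (w w' : List (Fin n))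
    (h : Step n w w') : I0 u w ↔ I0 u w' := by
  obtain ⟨p, r, i, h, rfl, rfl⟩ := h
  have wi := wt_g (n := n) i (by omega)
  have wl := wt_g (n := n) (n - 1) (by omega)
  cases p with
  | cons a p =>
    have : q n (p ++ ⟨0, by omega⟩ :: ⟨n - 1, by omega⟩ :: ⟨i, by omega⟩ :: r) =
      q n (p ++ ⟨i + 1, h⟩ :: ⟨n - 1, by omega⟩ :: r) := Step.q_eq ⟨p, r, i, h, rfl, rfl⟩
    simp only [List.cons_append, I0, this]
  | nil =>
    simp only [List.nil_append, I0, q_cons]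
    constructor
    · rintro (⟨-, h1⟩ | ⟨j, y, h1, -⟩)
      · exact Or.inr ⟨i, q n r, rfl, h1.symm, rfl⟩
      · omega
    · rintro (⟨h1, -⟩ | ⟨j, y, h1, h2, h3⟩)
      · omega
      · obtain rfl : i = j := by omega
        have := congrArg wt h2
        have h4 := congrArg wt h3
        simp only [wt_mul, wi, wl] at this h4
        have := hD _ (by omega) _ _ (by omega) h3
        left
        rw [this, h2]
        simp

theorem I1_step {D : ℕ} (hD : Canc n D) (k : ℕ) (hk : k + 1 < n) (u : Mn n)
    (hu : k + 2 + wt u = D) (w w' : List (Fin n))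
    (h : Step n w w') : I1 k u w ↔ I1 k u w' := by
  have wk := wt_g (n := n) k (by omega)
  obtain ⟨p, r, i, h, rfl, rfl⟩ := h
  have wi := wt_g (n := n) i (by omega)
  have wl := wt_g (n := n) (n - 1) (by omega)
  cases p with
  | cons a p =>
    have : q n (p ++ ⟨0, by omega⟩ :: ⟨n - 1, by omega⟩ :: ⟨i, by omega⟩ :: r) =
      q n (p ++ ⟨i + 1, h⟩ :: ⟨n - 1, by omega⟩ :: r) := Step.q_eq ⟨p, r, i, h, rfl, rfl⟩
    simp only [List.cons_append, I1, this]
  | nil =>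
    simp only [List.nil_append, I1, q_cons]
    constructor
    · rintro (⟨h1, -⟩ | ⟨y, -, h2, h3⟩ | ⟨j, y, y', -, h1, -⟩)
      · omega
      · by_cases hik : i = k
        · subst hik
          have h4 := congrArg wt h2
          have h5 := congrArg wt h3
          simp only [wt_mul, wi, wl] at h4 h5
          have h6 := hD _ (by omega) _ _
            (by simp only [wt_mul, wi]; omega) h3
          have h7 := hD _ (by omega) _ _ (by omega) h6
          left
          rw [h7, h2]
          simp
        · exact Or.inr (Or.inr ⟨i, y, q n r, hik, rfl, h2, rfl, h3.symm⟩)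
      · omega
    · rintro (⟨h1, h2⟩ | ⟨y, h1, -⟩ | ⟨j, y, y', hjk, h1, h2, h3, h4⟩)
      · obtain rfl : i = k := by omega
        exact Or.inr (Or.inl ⟨q n r, by simp, h2.symm, rfl⟩)
      · omega
      · obtain rfl : i = j := by omega
        have h5 := congrArg wt h2
        have h6 := congrArg wt h3
        have h7 := congrArg wt h4
        simp only [wt_mul, wi, wk, wl]
          at h5 h6 h7
        have h8 := hD _ (by omega) _ _ (by omega) h3
        refine Or.inr (Or.inl ⟨y, by simp, h2, ?_⟩)
        rw [h8, h4]

theorem canc (D : ℕ) : Canc n D := by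
  induction D with
  | zero => intro i _ u u' h; omega
  | succ D ih =>
    intro i hi u u' hw h
    by_cases hlt : i + 1 + wt u < D
    · exact ih i hi u u' hlt h
    have hD : i + 1 + wt u = D := by omega
    obtain ⟨l, rfl⟩ := q_surj u
    obtain ⟨l', rfl⟩ := q_surj u'
    have hq : q n (⟨i, hi⟩ :: l) = q n (⟨i, hi⟩ :: l') := by simpa only [q_cons] using h
    cases i with
    | zero =>
      have := (inv_of_q _ (I0_step ih (q n l) (by omega)) hq).1 (Or.inl ⟨rfl, rfl⟩)
      rcases this with ⟨-, h⟩ | ⟨i, y, h, -⟩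
      · exact h.symm
      · simp at h
    | succ k =>
      have := (inv_of_q _ (I1_step ih k hi (q n l) (by omega)) hq).1 (Or.inl ⟨rfl, rfl⟩)
      rcases this with ⟨-, h⟩ | ⟨y, h, -⟩ | ⟨j, y, y', hj, h, -⟩
      · exact h.symm
      · simp at h
      · simp at h; omega

theorem left_cancel (a u u' : Mn n) (h : a * u = a * u') : u = u' := by
  obtain ⟨l, rfl⟩ := q_surj a
  induction l with
  | nil =>
    have h1 : q n [] = 1 := map_one _
    simpa [h1] using h
  | cons b l ih =>
    rw [q_cons, mul_assoc, mul_assoc] at h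
    exact ih (canc _ _ b.2 _ _ (Nat.lt_succ_self _) h)

theorem rho_rel (i : ℕ) (h1 : 1 ≤ i) (h2 : i < n) :
    rho n 1 * rho n n * rho n i = rho n (i + 1) * rho n n := by
  rw [rho_eq 1 (by omega) (by omega), rho_eq n (by omega) (by omega), rho_eq i h1 (by omega),
    rho_eq (i + 1) (by omega) (by omega), mul_assoc]
  have := g_rel (n := n) (i - 1) (by omega)
  rwa [Nat.sub_add_cancel h1] at this

theorem rho_pow (i : ℕ) (h : i + 1 ≤ n) :
    rho n (i + 1) * rho n n ^ (i + 1) = (rho n 1 * rho n n) ^ (i + 1) := by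
  induction i with
  | zero => simp
  | succ i ih =>
    rw [pow_succ' _ (i + 1), ← mul_assoc, ← rho_rel (i + 1) (by omega) (by omega), mul_assoc,
      ih (by omega), ← pow_succ']

theorem pow_rho (k i : ℕ) (h1 : 1 ≤ i) (h : i + k ≤ n) :
    (rho n 1 * rho n n) ^ k * rho n i = rho n (i + k) * rho n n ^ k := by
  induction k with
  | zero => simp
  | succ k ih =>
    rw [pow_succ', mul_assoc, ih (by omega), ← mul_assoc, rho_rel (i + k) (by omega) (by omega),
      mul_assoc, ← pow_succ', add_assoc]

theorem alt_pow {M : Type*} [Monoid M] (x d : M) (k : ℕ) : x * (d * x) ^ k = (x * d) ^ k * x := by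
  induction k with
  | zero => simp
  | succ k ih => rw [pow_succ, ← mul_assoc, ih, pow_succ]; simp only [mul_assoc]

end MnAux

/-- Properties of the Garside element `Δ = ρ_n^{n+1}` of `M_n`. -/
theorem stmt7 (n : ℕ) (hn : 1 ≤ n) :
    rho n 1 * (rho n n * rho n 1) ^ (n - 1) = (rho n n) ^ n ∧
    (rho n n) ^ (n + 1) = (rho n 1 * rho n n) ^ n ∧
    (rho n n) ^ (n + 1) = (rho n n * rho n 1) ^ n ∧
    (∀ i : ℕ, 1 ≤ i → i ≤ n →
      rho n i * ((rho n n) ^ i * (rho n 1 * rho n n) ^ (n - i)) = (rho n n) ^ (n + 1) ∧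
      ((rho n n) ^ i * (rho n 1 * rho n n) ^ (n - i)) * rho n i = (rho n n) ^ (n + 1) ∧
      LDvd (rho n i) ((rho n n) ^ (n + 1)) ∧
      RDvd (rho n i) ((rho n n) ^ (n + 1))) ∧
    (∀ a : Mn n, (rho n n) ^ (n + 1) * a = a * (rho n n) ^ (n + 1)) ∧
    (∀ a b : Mn n, a * b = (rho n n) ^ (n + 1) → b * a = (rho n n) ^ (n + 1)) := by
  have hD : rho n n ^ (n + 1) = (rho n 1 * rho n n) ^ n := by
    have := MnAux.rho_pow (n := n) (n - 1) (by omega)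
    rw [Nat.sub_add_cancel hn] at this
    rw [← this, pow_succ']
  have h1 : rho n 1 * (rho n n * rho n 1) ^ (n - 1) = rho n n ^ n := by
    have := MnAux.pow_rho (n := n) (n - 1) 1 le_rfl (by omega)
    rw [MnAux.alt_pow, this, Nat.add_sub_cancel' hn, ← pow_succ', Nat.sub_add_cancel hn]
  have hgen : ∀ i : ℕ, 1 ≤ i → i ≤ n →
      rho n i * ((rho n n) ^ i * (rho n 1 * rho n n) ^ (n - i)) = (rho n n) ^ (n + 1) ∧
      ((rho n n) ^ i * (rho n 1 * rho n n) ^ (n - i)) * rho n i = (rho n n) ^ (n + 1) := by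
    intro i hi hin
    constructor
    · have := MnAux.rho_pow (n := n) (i - 1) (by omega)
      rw [Nat.sub_add_cancel hi] at this
      rw [← mul_assoc, this, ← pow_add, Nat.add_sub_cancel' hin, hD]
    · rw [mul_assoc, MnAux.pow_rho (n - i) i hi (by omega), Nat.add_sub_cancel' hin, ← pow_succ',
        ← pow_add]
      congr 1
      omega
  have hcomm : ∀ a : Mn n, (rho n n) ^ (n + 1) * a = a * (rho n n) ^ (n + 1) := by
    intro a
    obtain ⟨l, rfl⟩ := MnAux.q_surj a
    induction l with
    | nil =>
      have h1 : MnAux.q n [] = 1 := map_one _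
      simp [h1]
    | cons b l ih =>
      have hb : MnAux.g n b = rho n (b + 1) := by
        rw [MnAux.rho_eq _ (by omega) (by omega), Nat.add_sub_cancel]
      obtain ⟨e1, e2⟩ := hgen (b + 1) (by omega) (by omega)
      have e : rho n n ^ (n + 1) * rho n (b + 1) = rho n (b + 1) * rho n n ^ (n + 1) := by
        conv_lhs => rw [← e1]
        conv_rhs => rw [← e2]
        rw [mul_assoc]
      rw [MnAux.q_cons, hb, ← mul_assoc, e, mul_assoc, ih, mul_assoc]
  refine ⟨h1, hD, ?_, ?_, hcomm, ?_⟩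
  · rw [pow_succ', ← h1, ← mul_assoc, ← pow_succ', Nat.sub_add_cancel hn]
  · intro i hi hin
    obtain ⟨e1, e2⟩ := hgen i hi hin
    exact ⟨e1, e2, ⟨_, e1⟩, ⟨_, e2⟩⟩
  · intro a b hab
    apply MnAux.left_cancel a
    rw [← mul_assoc, hab, hcomm]
end
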